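/- Suppose for some integer τ ≥ 1 there exist symmetric positive definite matrices Q_i and matrices Y_{i,1},…,Y_{i,τ} ∈ ℝ^{m×n} for each i ∈ {1,…,N} such that, setting P_i := Q_i^{−1}, H_{i,k} := Y_{i,k} P_i, and letting Ê_i^k(S_1,…,S_k) ∈ ℝ^{n×n} denote the matrix with E_i^k(x,S_1,…,S_k) = Ê_i^k(S_1,…,S_k) x: (a) the block matrix [[Q_i, (Ê_i^1(S_1) Q_i)ᵀ],[Ê_i^1(S_1) Q_i, Q_i]] is positive definite for all i and all S_1 ⊆ {1,…,m}; (b) the block matrix [[Q_i, (Ê_i^τ(S_1,…,S_τ) Q_i)ᵀ],[Ê_i^τ(S_1,…,S_τ) Q_i, Q_j]] is positive definite for all i ≠ j and all S_1,…,S_τ ⊆ {1,…,m}; (c) the block matrix [[1, Y_{i,k}^{j•}],[(Y_{i,k}^{j•})ᵀ, Q_i]] is positive semidefinite for all i, all k = 1,…,τ, and all rows j = 1,…,m. Then the origin of the saturated switched system x(t+1) = F_{σ(t)}(x(t)) is locally asymptotically stable with dwell-time τ, and Ψ := ∩_{i=1}^N E(Q_i^{−1}) lies inside the domain of attraction: every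 trajectory under any DT-admissible switching signal with dwell-time τ starting from x(0) ∈ Ψ converges to 0 as t → ∞. -/

import Mathlib

open Matrix Filter

/-- Componentwise saturation: `sat(u)_j = sign(u_j) * min 1 |u_j|`. -/
noncomputable def satur {m : ℕ} (u : Fin m → ℝ) : Fin m → ℝ :=
  fun j => Real.sign (u j) * min 1 |u j|

/-- The closed-loop saturated map of mode `i`: `F_i(x) = A_i x + B_i sat(K_i x)`. -/
noncomputable def Fmode {n m N : ℕ} (A : Fin N → Matrix (Fin n) (Fin n) ℝ)
    (B : Fin N → Matrix (Fin n) (Fin m) ℝ) (K : Fin N → Matrix (Fin m) (Fin n) ℝ)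
    (i : Fin N) (x : Fin n → ℝ) : Fin n → ℝ :=
  (A i).mulVec x + (B i).mulVec (satur ((K i).mulVec x))

/-- A switching signal is DT-admissible with dwell-time `τ` : the first switch occurs
no earlier than time `τ`, and after any switch the signal stays constant for at
least `τ` steps. -/
def DTAdmissible {N : ℕ} (τ : ℕ) (σ : ℕ → Fin N) : Prop :=
  (∀ s < τ, σ s = σ 0) ∧ ∀ s, σ (s + 1) ≠ σ s → ∀ r < τ, σ (s + 1 + r) = σ (s + 1)

/-- `x : ℕ → ℝⁿ` is a trajectory of the switched system `x(t+1) = G_{σ(t)}(x(t))`. -/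
def Traj {n N : ℕ} (G : Fin N → (Fin n → ℝ) → (Fin n → ℝ)) (σ : ℕ → Fin N)
    (x : ℕ → Fin n → ℝ) : Prop :=
  ∀ t, x (t + 1) = G (σ t) (x t)

/-- Euclidean norm on `Fin n → ℝ`. -/
noncomputable def euclNorm {n : ℕ} (x : Fin n → ℝ) : ℝ :=
  Real.sqrt (∑ i, x i ^ 2)

/-- Representing matrix of the iterated vertex map: `EiterMat A B K H S t` is the matrix
`Ê^t(S_1, …, S_t)` with `Ê^t(S_1,…,S_t) x = E^t(x, S_1, …, S_t)`, where the auxiliary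
matrix of the `k`-th nesting level is `H (k-1)` and `S_k = S (k-1)`. -/
noncomputable def EiterMat {n m : ℕ} (A : Matrix (Fin n) (Fin n) ℝ)
    (B : Matrix (Fin n) (Fin m) ℝ) (K : Matrix (Fin m) (Fin n) ℝ)
    (H : ℕ → Matrix (Fin m) (Fin n) ℝ) (S : ℕ → Finset (Fin m)) :
    ℕ → Matrix (Fin n) (Fin n) ℝ
  | 0 => 1
  | (k + 1) =>
      (A + ∑ j ∈ (S k)ᶜ, vecMulVec (fun r => B r j) (K j)) * EiterMat A B K H S k
        + ∑ j ∈ S k, vecMulVec (fun r => B r j) (H k j)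

/-- A vector viewed as a `1 × n` (row) matrix. -/
def rowMat {n : ℕ} (v : Fin n → ℝ) : Matrix (Fin 1) (Fin n) ℝ :=
  Matrix.of fun _ l => v l

-- HELPERS
/-- Quadratic form. -/
noncomputable def Vq {n : ℕ} (P : Matrix (Fin n) (Fin n) ℝ) (x : Fin n → ℝ) : ℝ :=
  x ⬝ᵥ P.mulVec x

lemma Vq_smul {n : ℕ} (P : Matrix (Fin n) (Fin n) ℝ) (a : ℝ) (x : Fin n → ℝ) :
    Vq P (a • x) = a ^ 2 * Vq P x := by
  simp only [Vq, mulVec_smul, dotProduct_smul, smul_dotProduct, smul_eq_mul]; ring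

lemma Vq_cont {n : ℕ} (P : Matrix (Fin n) (Fin n) ℝ) : Continuous (Vq P) := by
  unfold Vq
  simp only [dotProduct, mulVec]
  fun_prop

lemma Vq_pos {n : ℕ} {P : Matrix (Fin n) (Fin n) ℝ} (hP : P.PosDef) {x : Fin n → ℝ}
    (hx : x ≠ 0) : 0 < Vq P x := by
  simpa [Vq] using hP.dotProduct_mulVec_pos hx

lemma Vq_nonneg {n : ℕ} {P : Matrix (Fin n) (Fin n) ℝ} (hP : P.PosDef) (x : Fin n → ℝ) :
    0 ≤ Vq P x := by
  simpa [Vq] using hP.posSemidef.dotProduct_mulVec_nonneg x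

lemma Vq_convex {n : ℕ} {P : Matrix (Fin n) (Fin n) ℝ} (hP : P.PosDef) (c : ℝ) :
    Convex ℝ {y | Vq P y ≤ c} := by
  intro y hy z hz a b ha hb hab
  simp only [Set.mem_setOf_eq] at *
  have h : Vq P (a • y + b • z) = a * Vq P y + b * Vq P z - a * b * Vq P (y - z) := by
    have hb' : b = 1 - a := by linarith
    subst hb'
    simp only [Vq, mulVec_smul, mulVec_add, mulVec_sub, dotProduct_smul, smul_dotProduct,
      smul_eq_mul, dotProduct_add, add_dotProduct, dotProduct_sub, sub_dotProduct]
    ring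
  have h2 := mul_nonneg (mul_nonneg ha hb) (Vq_nonneg hP (y - z))
  rw [h]
  have : a * Vq P y + b * Vq P z ≤ a * c + b * c := by gcongr
  have h3 : a * c + b * c = c := by rw [← add_mul, hab, one_mul]
  linarith

lemma ratio {n : ℕ} (f g : (Fin n → ℝ) → ℝ) (hf : Continuous f) (hg : Continuous g)
    (hf2 : ∀ (a : ℝ) x, f (a • x) = a ^ 2 * f x) (hg2 : ∀ (a : ℝ) x, g (a • x) = a ^ 2 * g x)
    (hpos : ∀ x, x ≠ 0 → 0 < g x) :
    ∃ l : ℝ, (∀ x, f x ≤ l * g x) ∧ (l = 0 ∨ ∃ x0, x0 ≠ 0 ∧ l = f x0 / g x0) := by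
  have f0 : f 0 = 0 := by simpa using hf2 0 0
  have g0 : g 0 = 0 := by simpa using hg2 0 0
  rcases (Metric.sphere (0 : Fin n → ℝ) 1).eq_empty_or_nonempty with he | hne
  · refine ⟨0, fun x => ?_, Or.inl rfl⟩
    by_cases hx : x = 0
    · simp [hx, f0]
    · exfalso
      have : ‖x‖⁻¹ • x ∈ Metric.sphere (0 : Fin n → ℝ) 1 := by
        simp [norm_smul, hx]
      rw [he] at this; exact this
  · have hs0 : ∀ x ∈ Metric.sphere (0 : Fin n → ℝ) 1, x ≠ 0 := by
      rintro x hx rfl; simp at hx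
    obtain ⟨x0, hx0, hm⟩ := (isCompact_sphere (0 : Fin n → ℝ) 1).exists_isMaxOn hne
      (f := fun x => f x / g x)
      (hf.continuousOn.div hg.continuousOn (fun x hx => (hpos x (hs0 x hx)).ne'))
    refine ⟨f x0 / g x0, fun x => ?_, Or.inr ⟨x0, hs0 x0 hx0, rfl⟩⟩
    by_cases hx : x = 0
    · simp [hx, f0, g0]
    · have hmem : ‖x‖⁻¹ • x ∈ Metric.sphere (0 : Fin n → ℝ) 1 := by
        simp [norm_smul, hx]
      have h := hm hmem
      simp only [Set.mem_setOf_eq, hf2, hg2] at h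
      have hn : ‖x‖⁻¹ ^ 2 ≠ 0 := by simp [hx]
      rw [mul_div_mul_left _ _ hn, div_le_iff₀ (hpos x hx)] at h
      exact h

lemma unif {α : Type*} {T : Set α} (hT : T.Finite) (p : α → ℝ → Prop)
    (hm : ∀ a l l', l ≤ l' → p a l → p a l')
    (h : ∀ a ∈ T, ∃ l < 1, p a l) : ∃ l, 0 ≤ l ∧ l < 1 ∧ ∀ a ∈ T, p a l := by
  induction T, hT using Set.Finite.induction_on with
  | empty => exact ⟨0, le_rfl, by norm_num, by simp⟩
  | @insert a s _ _ ih =>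
    obtain ⟨l, h0, h1, hl⟩ := ih (fun a ha => h a (Set.mem_insert_of_mem _ ha))
    obtain ⟨l', h1', hl'⟩ := h a (Set.mem_insert _ _)
    refine ⟨max l l', le_max_of_le_left h0, max_lt h1 h1', ?_⟩
    rintro b (rfl | hb)
    · exact hm _ _ _ (le_max_right _ _) hl'
    · exact hm _ _ _ (le_max_left _ _) (hl b hb)

lemma Eiter_finite {n m : ℕ} (A : Matrix (Fin n) (Fin n) ℝ)
    (B : Matrix (Fin n) (Fin m) ℝ) (K : Matrix (Fin m) (Fin n) ℝ)
    (H : ℕ → Matrix (Fin m) (Fin n) ℝ) (k : ℕ) :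
    (Set.range fun S => EiterMat A B K H S k).Finite := by
  induction k with
  | zero => exact (Set.finite_singleton 1).subset (by rintro _ ⟨S, rfl⟩; simp [EiterMat])
  | succ k ih =>
    refine (Set.Finite.image2 (fun (S : Finset (Fin m)) M =>
      (A + ∑ j ∈ Sᶜ, vecMulVec (fun r => B r j) (K j)) * M
        + ∑ j ∈ S, vecMulVec (fun r => B r j) (H k j)) Set.finite_univ ih).subset ?_
    rintro _ ⟨S, rfl⟩
    exact ⟨S k, Set.mem_univ _, _, ⟨S, rfl⟩, by simp [EiterMat]⟩

lemma Eiter_congr {n m : ℕ} (A : Matrix (Fin n) (Fin n) ℝ)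
    (B : Matrix (Fin n) (Fin m) ℝ) (K : Matrix (Fin m) (Fin n) ℝ)
    (H : ℕ → Matrix (Fin m) (Fin n) ℝ) (S S' : ℕ → Finset (Fin m)) (k : ℕ)
    (h : ∀ r < k, S r = S' r) : EiterMat A B K H S k = EiterMat A B K H S' k := by
  induction k with
  | zero => rfl
  | succ k ih =>
    simp only [EiterMat]
    rw [ih (fun r hr => h r (by omega)), h k (by omega)]

lemma Qinv_mul {n : ℕ} {Q : Matrix (Fin n) (Fin n) ℝ} (hQ : Q.PosDef) (x : Fin n → ℝ) :
    Q *ᵥ (Q⁻¹ *ᵥ x) = x := by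
  rw [mulVec_mulVec, mul_nonsing_inv _ ((isUnit_iff_isUnit_det _).1 hQ.isUnit), one_mulVec]

lemma block_lt {n : ℕ} {Q R M : Matrix (Fin n) (Fin n) ℝ} (hQ : Q.PosDef) (hR : R.PosDef)
    (h : (fromBlocks Q (M * Q)ᵀ (M * Q) R).PosDef) (x : Fin n → ℝ) (hx : x ≠ 0) :
    Vq R⁻¹ (M *ᵥ x) < Vq Q⁻¹ x := by
  have hne : Sum.elim (Q⁻¹ *ᵥ x) (-(R⁻¹ *ᵥ (M *ᵥ x))) ≠ 0 := by
    intro h0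
    have : Q⁻¹ *ᵥ x = 0 := by
      ext a; simpa using congrFun h0 (Sum.inl a)
    apply hx
    rw [← Qinv_mul hQ x, this, mulVec_zero]
  have := h.dotProduct_mulVec_pos hne
  rw [star_trivial, fromBlocks_mulVec, dotProduct_block] at this
  simp only [Sum.elim_comp_inl, Sum.elim_comp_inr, mulVec_neg, Qinv_mul hQ, Qinv_mul hR,
    ← mulVec_mulVec, mulVec_transpose, ← mulVec_mulVec, dotProduct_add, neg_dotProduct, dotProduct_neg] at this
  have e : (Q⁻¹ *ᵥ x) ⬝ᵥ ((R⁻¹ *ᵥ (M *ᵥ x)) ᵥ* (M * Q)) = (R⁻¹ *ᵥ (M *ᵥ x)) ⬝ᵥ (M *ᵥ x) := by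
    rw [dotProduct_comm, ← dotProduct_mulVec, ← mulVec_mulVec, Qinv_mul hQ]
  rw [e] at this
  simp only [Vq]
  rw [dotProduct_comm, dotProduct_comm x]
  linarith

lemma row_le {n : ℕ} {Q : Matrix (Fin n) (Fin n) ℝ} (hQ : Q.PosDef) (y : Fin n → ℝ)
    (h : (fromBlocks (1 : Matrix (Fin 1) (Fin 1) ℝ) (rowMat y) (rowMat y)ᵀ Q).PosSemidef)
    (x : Fin n → ℝ) (hx : Vq Q⁻¹ x ≤ 1) : |y ⬝ᵥ (Q⁻¹ *ᵥ x)| ≤ 1 := by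
  have key : ∀ a : ℝ, 0 ≤ a ^ 2 + 2 * a * (y ⬝ᵥ (Q⁻¹ *ᵥ x)) + Vq Q⁻¹ x := by
    intro a
    have := h.dotProduct_mulVec_nonneg (Sum.elim (fun _ => a) (Q⁻¹ *ᵥ x))
    rw [star_trivial, fromBlocks_mulVec, dotProduct_block] at this
    simp only [Sum.elim_comp_inl, Sum.elim_comp_inr, Qinv_mul hQ, dotProduct_add] at this
    have e1 : (Q⁻¹ *ᵥ x) ⬝ᵥ ((rowMat y)ᵀ *ᵥ fun _ => a) = a * (y ⬝ᵥ (Q⁻¹ *ᵥ x)) := by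
      rw [mulVec_transpose, dotProduct_comm, ← dotProduct_mulVec]
      simp [dotProduct, mulVec, rowMat]
    have e2 : (fun _ : Fin 1 => a) ⬝ᵥ (rowMat y *ᵥ (Q⁻¹ *ᵥ x)) = a * (y ⬝ᵥ (Q⁻¹ *ᵥ x)) := by
      simp [dotProduct, mulVec, rowMat]
    have e3 : (fun _ : Fin 1 => a) ⬝ᵥ ((1 : Matrix (Fin 1) (Fin 1) ℝ) *ᵥ fun _ => a) = a ^ 2 := by
      simp [dotProduct, sq]
    rw [e1, e2, e3] at this
    rw [Vq, dotProduct_comm x]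
    linarith
  have h1 := key 1
  have h2 := key (-1)
  rw [abs_le]
  constructor <;> nlinarith

lemma sat_mem (u h : ℝ) (hh : |h| ≤ 1) : Real.sign u * min 1 |u| ∈ convexHull ℝ {u, h} := by
  rw [convexHull_pair, segment_eq_uIcc, Set.mem_uIcc]
  rw [abs_le] at hh
  rcases lt_trichotomy u 0 with h0 | h0 | h0
  · rw [Real.sign_of_neg h0, abs_of_neg h0]
    rcases le_total 1 (-u) with h1 | h1
    · rw [min_eq_left h1]; left; constructor <;> linarith
    · rw [min_eq_right h1]
      rcases le_total u h with h2 | h2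
      · left; constructor <;> linarith
      · right; constructor <;> linarith
  · subst h0; simp; exact le_total _ _
  · rw [Real.sign_of_pos h0, abs_of_pos h0]
    rcases le_total 1 u with h1 | h1
    · rw [min_eq_left h1]; right; constructor <;> linarith
    · rw [min_eq_right h1]
      rcases le_total u h with h2 | h2
      · left; constructor <;> linarith
      · right; constructor <;> linarith

lemma conv_pre {p q : ℕ} (M : Matrix (Fin p) (Fin q) ℝ) (c : Fin p → ℝ)
    (s : Set (Fin p → ℝ)) (hs : Convex ℝ s) : Convex ℝ {z | M *ᵥ z + c ∈ s} := by
  intro y hy z hz a b ha hb hab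
  simp only [Set.mem_setOf_eq] at *
  have : M *ᵥ (a • y + b • z) + c = a • (M *ᵥ y + c) + b • (M *ᵥ z + c) := by
    have hc : c = a • c + b • c := by rw [← add_smul, hab, one_smul]
    nth_rewrite 1 [hc]
    simp only [mulVec_add, mulVec_smul, smul_add]
    abel
  rw [this]
  exact hs hy hz ha hb hab

lemma step_mem {n m : ℕ} (A : Matrix (Fin n) (Fin n) ℝ)
    (B : Matrix (Fin n) (Fin m) ℝ) (K : Matrix (Fin m) (Fin n) ℝ) (z : Fin n → ℝ)
    (h : Fin m → ℝ) (hh : ∀ j, |h j| ≤ 1) (s : Set (Fin n → ℝ)) (hs : Convex ℝ s)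
    (hv : ∀ S : Finset (Fin m), (A + ∑ j ∈ Sᶜ, vecMulVec (fun r => B r j) (K j)) *ᵥ z
      + ∑ j ∈ S, h j • (fun r => B r j) ∈ s) :
    A *ᵥ z + B *ᵥ satur (K *ᵥ z) ∈ s := by
  have h1 : satur (K *ᵥ z) ∈ convexHull ℝ
      (Set.univ.pi fun j => ({(K *ᵥ z) j, h j} : Set ℝ)) :=
    mem_convexHull_pi (fun j _ => sat_mem _ _ (hh j))
  have h2 : convexHull ℝ (Set.univ.pi fun j => ({(K *ᵥ z) j, h j} : Set ℝ))
      ⊆ {v | B *ᵥ v + A *ᵥ z ∈ s} := by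
    refine convexHull_min ?_ (conv_pre _ _ _ hs)
    intro v hv'
    classical
    have hS := hv (Finset.univ.filter fun j => v j = h j)
    simp only [Set.mem_setOf_eq]
    convert hS using 1
    rw [add_mulVec, add_comm, add_assoc]
    congr 1
    have e : B *ᵥ v = ∑ j, v j • (fun r => B r j) := by
      ext r; simp [mulVec, dotProduct, mul_comm]
    rw [e, ← Finset.sum_compl_add_sum (Finset.univ.filter fun j => v j = h j), sum_mulVec]
    congr 1
    · refine Finset.sum_congr rfl fun j hj => ?_
      have hj' : v j = (K *ᵥ z) j := by
        have := hv' j (Set.mem_univ _)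
        simp at hj this
        tauto
      rw [vecMulVec_mulVec, hj']
      ext r
      simp [mulVec, mul_comm]
    · refine Finset.sum_congr rfl fun j hj => ?_
      simp at hj
      rw [hj]
  have := h2 h1
  rw [add_comm]; exact this

lemma iter_mem {n m : ℕ} (A : Matrix (Fin n) (Fin n) ℝ)
    (B : Matrix (Fin n) (Fin m) ℝ) (K : Matrix (Fin m) (Fin n) ℝ)
    (H : ℕ → Matrix (Fin m) (Fin n) ℝ) (τ : ℕ) (x : Fin n → ℝ)
    (hH : ∀ k < τ, ∀ j, |(H k *ᵥ x) j| ≤ 1) (k : ℕ) (hk : k ≤ τ) :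
    (fun z => A *ᵥ z + B *ᵥ satur (K *ᵥ z))^[k] x ∈
      convexHull ℝ (Set.range fun S => EiterMat A B K H S k *ᵥ x) := by
  induction k with
  | zero => exact subset_convexHull _ _ ⟨fun _ => ∅, by simp [EiterMat]⟩
  | succ k ih =>
    rw [Function.iterate_succ_apply']
    refine step_mem A B K _ (H k *ᵥ x) (hH k (by omega)) _ (convex_convexHull _ _) ?_
    intro S
    refine convexHull_min ?_ (conv_pre _ _ _ (convex_convexHull _ _)) (ih (by omega))
    rintro _ ⟨S0, rfl⟩
    refine subset_convexHull _ _ ⟨Function.update S0 k S, ?_⟩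
    simp only [EiterMat, Function.update_self]
    rw [Eiter_congr A B K H (Function.update S0 k S) S0 k
      (fun r hr => Function.update_of_ne (by omega) _ _)]
    rw [add_mulVec, ← mulVec_mulVec, sum_mulVec]
    congr 1
    refine Finset.sum_congr rfl fun j hj => ?_
    rw [vecMulVec_mulVec]
    ext r
    simp [mulVec, mul_comm]

lemma contr {n m : ℕ} (A : Matrix (Fin n) (Fin n) ℝ)
    (B : Matrix (Fin n) (Fin m) ℝ) (K : Matrix (Fin m) (Fin n) ℝ)
    (τ k : ℕ) (hk : k ≤ τ) (Q R : Matrix (Fin n) (Fin n) ℝ) (hQ : Q.PosDef) (hR : R.PosDef)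
    (Y : ℕ → Matrix (Fin m) (Fin n) ℝ)
    (hb : ∀ S : ℕ → Finset (Fin m),
      (Matrix.fromBlocks Q (EiterMat A B K (fun k => Y k * Q⁻¹) S k * Q)ᵀ
        (EiterMat A B K (fun k => Y k * Q⁻¹) S k * Q) R).PosDef)
    (hc : ∀ k < τ, ∀ jr : Fin m,
      (Matrix.fromBlocks (1 : Matrix (Fin 1) (Fin 1) ℝ) (rowMat (Y k jr))
        (rowMat (Y k jr))ᵀ Q).PosSemidef) :
    ∃ l < 1, ∀ x, Vq Q⁻¹ x ≤ 1 →
      Vq R⁻¹ ((fun z => A *ᵥ z + B *ᵥ satur (K *ᵥ z))^[k] x) ≤ l * Vq Q⁻¹ x := by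
  obtain ⟨l, -, h1, hl⟩ := unif (Eiter_finite A B K (fun k => Y k * Q⁻¹) k)
    (fun M l => ∀ x, Vq R⁻¹ (M *ᵥ x) ≤ l * Vq Q⁻¹ x)
    (fun M l l' hll h x => (h x).trans
      (mul_le_mul_of_nonneg_right hll (Vq_nonneg hQ.inv x))) (by
    rintro _ ⟨S, rfl⟩
    obtain ⟨l, hl, hl'⟩ := ratio
      (fun x => Vq R⁻¹ (EiterMat A B K (fun k => Y k * Q⁻¹) S k *ᵥ x)) (Vq Q⁻¹)
      ((Vq_cont _).comp (Continuous.matrix_mulVec continuous_const continuous_id)) (Vq_cont _)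
      (fun a x => by rw [mulVec_smul, Vq_smul]) (Vq_smul _) (fun x hx => Vq_pos hQ.inv hx)
    refine ⟨l, ?_, hl⟩
    rcases hl' with rfl | ⟨x0, h0, rfl⟩
    · norm_num
    · rw [div_lt_one (Vq_pos hQ.inv h0)]
      exact block_lt hQ hR (hb S) x0 h0)
  refine ⟨l, h1, fun x hx => ?_⟩
  have hm := iter_mem A B K (fun k => Y k * Q⁻¹) τ x (fun k hk j => by
    have := row_le hQ (Y k j) (hc k hk j) x hx
    rw [← mulVec_mulVec]; exact this) k hk
  refine convexHull_min ?_ (Vq_convex hR.inv (l * Vq Q⁻¹ x)) hm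
  rintro _ ⟨S, rfl⟩
  exact hl _ ⟨S, rfl⟩ x

lemma dwell {N : ℕ} {τ : ℕ} {σ : ℕ → Fin N} (h : DTAdmissible τ σ) (s : ℕ)
    (hs : σ (s + 1) ≠ σ s) :
    τ ≤ s + 1 ∧ ∀ r, r ≤ s → s + 1 ≤ r + τ → σ r = σ s := by
  refine ⟨?_, ?_⟩
  · by_contra hlt
    exact hs ((h.1 (s + 1) (by omega)).trans (h.1 s (by omega)).symm)
  · intro r hr
    obtain ⟨d, rfl⟩ := Nat.exists_eq_add_of_le hr
    clear hr
    induction d generalizing r with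
    | zero => intro _; rfl
    | succ d ih =>
      intro hrt
      have e : r + (d + 1) = r + 1 + d := by omega
      rw [e] at hs hrt ⊢
      have ih' := ih (r + 1) hs (by omega)
      by_contra hne
      have hsw : σ (r + 1) ≠ σ r := fun e => hne (e.symm.trans ih')
      have := h.2 r hsw (d + 1) (by omega)
      exact hs (this.trans ih')

lemma euclNorm_sq {n : ℕ} (x : Fin n → ℝ) : euclNorm x ^ 2 = Vq 1 x := by
  rw [euclNorm, Real.sq_sqrt (Finset.sum_nonneg fun i _ => sq_nonneg _)]
  simp [Vq, dotProduct, sq]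

lemma traj_iter {n N : ℕ} {G : Fin N → (Fin n → ℝ) → (Fin n → ℝ)} {σ : ℕ → Fin N}
    {x : ℕ → Fin n → ℝ} (hx : Traj G σ x) (t k : ℕ) (i : Fin N)
    (h : ∀ r < k, σ (t + r) = i) : x (t + k) = (G i)^[k] (x t) := by
  induction k with
  | zero => rfl
  | succ k ih =>
    rw [Function.iterate_succ_apply', ← ih (fun r hr => h r (by omega)), ← add_assoc, hx,
      h k (by omega)]

/-- Corollary 3: feasibility of the LMIs (in the variables `Q_i ≻ 0`, `Y_{i,k}`, with
`P_i = Q_i⁻¹` and `H_{i,k} = Y_{i,k} P_i`) implies local asymptotic stability with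
dwell-time `τ`, and `Ψ = ∩ᵢ E(Q_i⁻¹)` lies in the domain of attraction. -/
theorem stmt14 {n m N : ℕ} (A : Fin N → Matrix (Fin n) (Fin n) ℝ)
    (B : Fin N → Matrix (Fin n) (Fin m) ℝ) (K : Fin N → Matrix (Fin m) (Fin n) ℝ)
    (τ : ℕ) (hτ : 1 ≤ τ)
    (Q : Fin N → Matrix (Fin n) (Fin n) ℝ) (hQ : ∀ i, (Q i).PosDef)
    (Y : Fin N → ℕ → Matrix (Fin m) (Fin n) ℝ)
    (ha : ∀ i : Fin N, ∀ S : ℕ → Finset (Fin m),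
      (Matrix.fromBlocks (Q i)
        (EiterMat (A i) (B i) (K i) (fun k => Y i k * (Q i)⁻¹) S 1 * Q i)ᵀ
        (EiterMat (A i) (B i) (K i) (fun k => Y i k * (Q i)⁻¹) S 1 * Q i)
        (Q i)).PosDef)
    (hb : ∀ i j : Fin N, i ≠ j → ∀ S : ℕ → Finset (Fin m),
      (Matrix.fromBlocks (Q i)
        (EiterMat (A i) (B i) (K i) (fun k => Y i k * (Q i)⁻¹) S τ * Q i)ᵀ
        (EiterMat (A i) (B i) (K i) (fun k => Y i k * (Q i)⁻¹) S τ * Q i)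
        (Q j)).PosDef)
    (hc : ∀ i : Fin N, ∀ k < τ, ∀ jr : Fin m,
      (Matrix.fromBlocks (1 : Matrix (Fin 1) (Fin 1) ℝ) (rowMat (Y i k jr))
        (rowMat (Y i k jr))ᵀ (Q i)).PosSemidef) :
    (∀ ε > (0 : ℝ), ∃ δ > (0 : ℝ), ∀ σ : ℕ → Fin N, DTAdmissible τ σ →
      ∀ x : ℕ → Fin n → ℝ, Traj (Fmode A B K) σ x → euclNorm (x 0) ≤ δ →
        ∀ t, euclNorm (x t) ≤ ε) ∧
    (∀ σ : ℕ → Fin N, DTAdmissible τ σ → ∀ x : ℕ → Fin n → ℝ,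
      Traj (Fmode A B K) σ x → (∀ i, x 0 ⬝ᵥ ((Q i)⁻¹).mulVec (x 0) ≤ 1) →
        Tendsto x atTop (nhds 0)) := by
  have hone : (1 : Matrix (Fin n) (Fin n) ℝ).PosDef := PosDef.one
  obtain ⟨l1, hl10, hl11, hl1⟩ := unif (Set.finite_univ (α := Fin N))
    (fun i l => ∀ x, Vq (Q i)⁻¹ x ≤ 1 →
      Vq (Q i)⁻¹ (Fmode A B K i x) ≤ l * Vq (Q i)⁻¹ x)
    (fun i l l' hll h x hx => (h x hx).trans
      (mul_le_mul_of_nonneg_right hll (Vq_nonneg (hQ i).inv x)))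
    (fun i _ => contr (A i) (B i) (K i) τ 1 hτ (Q i) (Q i) (hQ i) (hQ i) (Y i) (ha i) (hc i))
  obtain ⟨l2, hl20, hl21, hl2⟩ := unif (Set.toFinite {p : Fin N × Fin N | p.1 ≠ p.2})
    (fun p l => ∀ x, Vq (Q p.1)⁻¹ x ≤ 1 →
      Vq (Q p.2)⁻¹ ((Fmode A B K p.1)^[τ] x) ≤ l * Vq (Q p.1)⁻¹ x)
    (fun p l l' hll h x hx => (h x hx).trans
      (mul_le_mul_of_nonneg_right hll (Vq_nonneg (hQ p.1).inv x)))
    (fun p hp => contr (A p.1) (B p.1) (K p.1) τ τ le_rfl (Q p.1) (Q p.2) (hQ _) (hQ _) (Y p.1)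
      (hb p.1 p.2 hp) (hc p.1))
  obtain ⟨ρ, hρ0, hρ1, hρτ⟩ : ∃ ρ : ℝ, 0 ≤ ρ ∧ ρ < 1 ∧ max l1 l2 ≤ ρ ^ τ := by
    have hm0 : 0 ≤ max l1 l2 := le_max_of_le_left hl10
    have hm1 : max l1 l2 < 1 := max_lt hl11 hl21
    generalize max l1 l2 = l at *
    have hτ' : (1 : ℝ) ≤ τ := by exact_mod_cast hτ
    have hd : (1 - l) / τ ≤ 1 := by rw [div_le_one (by linarith)]; linarith
    have hd0 : 0 < (1 - l) / τ := div_pos (by linarith) (by linarith)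
    refine ⟨1 - (1 - l) / τ, by linarith, by linarith, ?_⟩
    have := one_add_mul_le_pow (a := -((1 - l) / τ)) (by linarith) τ
    have e : (τ : ℝ) * ((1 - l) / τ) = 1 - l := by field_simp
    rw [← sub_eq_add_neg] at this
    linarith
  have hρτ' : ρ ^ τ ≤ ρ := pow_le_of_le_one hρ0 hρ1.le (by omega)
  have decay : ∀ σ : ℕ → Fin N, DTAdmissible τ σ → ∀ x : ℕ → Fin n → ℝ,
      Traj (Fmode A B K) σ x → Vq (Q (σ 0))⁻¹ (x 0) ≤ 1 →
      ∀ t, Vq (Q (σ t))⁻¹ (x t) ≤ ρ ^ t * Vq (Q (σ 0))⁻¹ (x 0) := by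
    intro σ hσ x hx h0 t
    have hW0 := Vq_nonneg (hQ (σ 0)).inv (x 0)
    induction t using Nat.strong_induction_on with
    | _ t ih =>
      have hle : ∀ s < t, Vq (Q (σ s))⁻¹ (x s) ≤ 1 := fun s hs =>
        (ih s hs).trans (mul_le_one₀ (pow_le_one₀ hρ0 hρ1.le) hW0 h0)
      rcases t with _ | s
      · simp
      · by_cases hsw : σ (s + 1) = σ s
        · rw [hsw, hx s]
          have h1 := hl1 (σ s) (Set.mem_univ _) (x s) (hle s (by omega))
          have h2 := ih s (by omega)
          calc _ ≤ l1 * Vq (Q (σ s))⁻¹ (x s) := h1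
            _ ≤ ρ * (ρ ^ s * Vq (Q (σ 0))⁻¹ (x 0)) :=
              mul_le_mul (((le_max_left _ _).trans hρτ).trans hρτ') h2
                (Vq_nonneg (hQ _).inv _) hρ0
            _ = _ := by ring
        · obtain ⟨hτs, hcon⟩ := dwell hσ s hsw
          obtain ⟨r, hr⟩ : ∃ r, s + 1 = r + τ := ⟨s + 1 - τ, by omega⟩
          have hσr : σ r = σ s := hcon r (by omega) (by omega)
          have hxi : x (s + 1) = (Fmode A B K (σ s))^[τ] (x r) := by
            rw [hr]
            exact traj_iter hx r τ (σ s) (fun q hq => hcon _ (by omega) (by omega))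
          have h2 := ih r (by omega)
          have h3 := hle r (by omega)
          rw [hσr] at h2 h3
          have h1 := hl2 (σ s, σ (s + 1)) (fun e => hsw e.symm) (x r) h3
          rw [hxi]
          calc _ ≤ l2 * Vq (Q (σ s))⁻¹ (x r) := h1
            _ ≤ ρ ^ τ * (ρ ^ r * Vq (Q (σ 0))⁻¹ (x 0)) :=
              mul_le_mul ((le_max_right _ _).trans hρτ) h2
                (Vq_nonneg (hQ _).inv _) (pow_nonneg hρ0 _)
            _ = _ := by rw [hr, pow_add]; ring
  obtain ⟨C, hC⟩ : ∃ C : ℝ, ∀ i x, Vq (Q i)⁻¹ x ≤ C * Vq 1 x := by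
    have : ∀ i, ∃ c : ℝ, ∀ x, Vq (Q i)⁻¹ x ≤ c * Vq 1 x := fun i =>
      (ratio _ _ (Vq_cont _) (Vq_cont _) (Vq_smul _) (Vq_smul _)
        (fun x hx => Vq_pos hone hx)).imp fun c h => h.1
    choose c hc' using this
    obtain ⟨C, hC⟩ := Finite.exists_le c
    exact ⟨C, fun i x => (hc' i x).trans (mul_le_mul_of_nonneg_right (hC i) (Vq_nonneg hone x))⟩
  obtain ⟨D, hD⟩ : ∃ D : ℝ, ∀ i x, Vq 1 x ≤ D * Vq (Q i)⁻¹ x := by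
    have : ∀ i, ∃ c : ℝ, ∀ x, Vq 1 x ≤ c * Vq (Q i)⁻¹ x := fun i =>
      (ratio _ _ (Vq_cont _) (Vq_cont _) (Vq_smul _) (Vq_smul _)
        (fun x hx => Vq_pos (hQ i).inv hx)).imp fun c h => h.1
    choose c hc' using this
    obtain ⟨C, hC⟩ := Finite.exists_le c
    exact ⟨C, fun i x => (hc' i x).trans
      (mul_le_mul_of_nonneg_right (hC i) (Vq_nonneg (hQ i).inv x))⟩
  constructor
  · intro ε hε
    set C' := max C 1
    set D' := max D 1
    have hC' : 1 ≤ C' := le_max_right _ _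
    have hD' : 1 ≤ D' := le_max_right _ _
    obtain ⟨δ, hδ, hδ1⟩ : ∃ δ > (0 : ℝ), C' * δ ^ 2 ≤ min 1 (ε ^ 2 / D') := by
      refine ⟨√(min 1 (ε ^ 2 / D') / C'), Real.sqrt_pos.2 (by positivity), ?_⟩
      rw [Real.sq_sqrt (by positivity)]
      exact le_of_eq (by field_simp)
    refine ⟨δ, hδ, fun σ hσ x hx h0 t => ?_⟩
    have hn0 : 0 ≤ euclNorm (x 0) := Real.sqrt_nonneg _
    have hV0 : Vq (Q (σ 0))⁻¹ (x 0) ≤ C' * δ ^ 2 := by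
      calc _ ≤ C * Vq 1 (x 0) := hC _ _
        _ ≤ C' * Vq 1 (x 0) := mul_le_mul_of_nonneg_right (le_max_left _ _) (Vq_nonneg hone _)
        _ ≤ C' * δ ^ 2 := by rw [← euclNorm_sq]; gcongr
    have h := decay σ hσ x hx (hV0.trans (hδ1.trans (min_le_left _ _))) t
    have hW0 := Vq_nonneg (hQ (σ 0)).inv (x 0)
    have h2 : Vq (Q (σ t))⁻¹ (x t) ≤ ε ^ 2 / D' :=
      (h.trans (mul_le_of_le_one_left hW0 (pow_le_one₀ hρ0 hρ1.le))).trans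
        (hV0.trans (hδ1.trans (min_le_right _ _)))
    have h3 : euclNorm (x t) ^ 2 ≤ ε ^ 2 := by
      rw [euclNorm_sq]
      calc _ ≤ D * Vq (Q (σ t))⁻¹ (x t) := hD _ _
        _ ≤ D' * Vq (Q (σ t))⁻¹ (x t) :=
          mul_le_mul_of_nonneg_right (le_max_left _ _) (Vq_nonneg (hQ _).inv _)
        _ ≤ D' * (ε ^ 2 / D') := by gcongr
        _ = ε ^ 2 := by field_simp
    exact le_of_sq_le_sq h3 hε.le
  · intro σ hσ x hx h0
    have h := decay σ hσ x hx (h0 (σ 0))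
    have hW0 := Vq_nonneg (hQ (σ 0)).inv (x 0)
    set W := Vq (Q (σ 0))⁻¹ (x 0)
    rw [tendsto_pi_nhds]
    intro a
    refine squeeze_zero_norm (a := fun t => √(max D 1 * (ρ ^ t * W))) (fun t => ?_) ?_
    · refine Real.abs_le_sqrt ?_
      have h1 : x t a ^ 2 ≤ Vq 1 (x t) := by
        rw [← euclNorm_sq, euclNorm, Real.sq_sqrt (Finset.sum_nonneg fun i _ => sq_nonneg _)]
        exact Finset.single_le_sum (f := fun i => x t i ^ 2) (fun i _ => sq_nonneg _)
          (Finset.mem_univ a)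
      calc _ ≤ _ := h1
        _ ≤ D * Vq (Q (σ t))⁻¹ (x t) := hD _ _
        _ ≤ max D 1 * Vq (Q (σ t))⁻¹ (x t) :=
          mul_le_mul_of_nonneg_right (le_max_left _ _) (Vq_nonneg (hQ _).inv _)
        _ ≤ _ := by gcongr; exact h t
    · have h1 := tendsto_pow_atTop_nhds_zero_of_lt_one hρ0 hρ1
      have h2 := ((h1.mul_const W).const_mul (max D 1)).sqrt
      simpa using h2
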